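/- arXiv:1611.06037 — 5 statements merged into one kernel-verified Lean document; each statement's English description precedes it below -/
import Mathlib

section
/- Let I ∈ ℍ be an imaginary unit and let (a_n)_{n≥1} be a sequence of quaternions lying on the slice L_I with ‖a_n‖ < 1 for all n. Then the quaternionic Malmquist–Takenaka functions Φ_n are orthonormal with respect to the boundary inner product on the slice: for all m, n ≥ 1, (1/(2π))·∫₀^{2π} conj(Φ_m(e^{Iθ}))·Φ_n(e^{Iθ}) dθ equals 1 (in ℍ) if m = n and equals 0 if m ≠ n. (This is Theorem 4.1: when all parameters lie on one slice, the slice regular Malmquist–Takenaka system coincides on that slice with the classical formula below, and the H²(𝔹) inner product of two such functions equals this boundary integral.) -/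
open scoped Real
noncomputable section

/-- The classical quaternionic Blaschke function `B_a(q) = (1 - q·conj(a))⁻¹·(q - a)`. -/
def B (a q : Quaternion ℝ) : Quaternion ℝ := (1 - q * star a)⁻¹ * (q - a)

/-- The classical quaternionic Malmquist–Takenaka functions
`Φ_n(q) = √(1 - ‖a_n‖²)·(∏_{k=1}^{n-1} B_{a_k}(q))·(1 - q·conj(a_n))⁻¹`,
the product taken in increasing order of `k`. -/
def Phi (a : ℕ → Quaternion ℝ) (n : ℕ) (q : Quaternion ℝ) : Quaternion ℝ :=
  (Real.sqrt (1 - ‖a n‖ ^ 2) : Quaternion ℝ) *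
    (((List.range (n - 1)).map (fun k => B (a (k + 1)) q)).prod) *
    (1 - q * star (a n))⁻¹

/-- `e^{Iθ} = cos θ + (sin θ)•I`. -/
def expI (I : Quaternion ℝ) (θ : ℝ) : Quaternion ℝ :=
  (Real.cos θ : Quaternion ℝ) + Real.sin θ • I

open ComplexConjugate in
/-- The complex Malmquist–Takenaka function with parameters `α 0, …, α n`. -/
def complexMT (α : ℕ → ℂ) (n : ℕ) (z : ℂ) : ℂ :=
  (Real.sqrt (1 - ‖α n‖ ^ 2) : ℂ) *
    (∏ k ∈ Finset.range n, (1 - z * conj (α k))⁻¹ * (z - α k)) * (1 - z * conj (α n))⁻¹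

section Complex

open ComplexConjugate Metric

lemma one_sub_mul_conj_ne_zero {w z : ℂ} (hw : ‖w‖ < 1) (hz : ‖z‖ ≤ 1) :
    1 - z * conj w ≠ 0 := by
  intro h
  have h1 : ‖z * conj w‖ = 1 := by rw [← sub_eq_zero.mp h, norm_one]
  rw [norm_mul, RCLike.norm_conj] at h1
  nlinarith [norm_nonneg w, norm_nonneg z]

lemma sub_ne_zero_of_norm_lt_one {w z : ℂ} (hw : ‖w‖ < 1) (hz : ‖z‖ = 1) : z - w ≠ 0 := by
  intro h
  rw [sub_eq_zero.mp h] at hz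
  exact hw.ne hz

lemma conj_eq_inv_of_norm_eq_one {z : ℂ} (hz : ‖z‖ = 1) : conj z = z⁻¹ := by
  rw [Complex.inv_def, Complex.normSq_eq_norm_sq, hz]
  simp

lemma conj_inv_one_sub_mul_conj {w z : ℂ} (hw : ‖w‖ < 1) (hz : ‖z‖ = 1) :
    conj (1 - z * conj w)⁻¹ = z * (z - w)⁻¹ := by
  have hz0 : z ≠ 0 := norm_ne_zero_iff.mp (by rw [hz]; exact one_ne_zero)
  have h1 := sub_ne_zero_of_norm_lt_one hw hz
  have h2 : 1 - z⁻¹ * w = z⁻¹ * (z - w) := by field_simp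
  simp only [map_inv₀, map_sub, map_one, map_mul, Complex.conj_conj,
    conj_eq_inv_of_norm_eq_one hz]
  rw [h2, mul_inv, inv_inv]

lemma conj_blaschke_mul_self {w z : ℂ} (hw : ‖w‖ < 1) (hz : ‖z‖ = 1) :
    conj ((1 - z * conj w)⁻¹ * (z - w)) * ((1 - z * conj w)⁻¹ * (z - w)) = 1 := by
  have hz0 : z ≠ 0 := norm_ne_zero_iff.mp (by rw [hz]; exact one_ne_zero)
  have h1 := sub_ne_zero_of_norm_lt_one hw hz
  have h2 := one_sub_mul_conj_ne_zero hw hz.le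
  have h3 : z⁻¹ - conj w = z⁻¹ * (1 - z * conj w) := by field_simp
  rw [map_mul, conj_inv_one_sub_mul_conj hw hz, map_sub, conj_eq_inv_of_norm_eq_one hz, h3]
  field_simp

lemma integral_mul_circleMap_eq_circleIntegral (h : ℂ → ℂ) :
    ∫ θ in (0 : ℝ)..(2 * π), circleMap 0 1 θ * h (circleMap 0 1 θ) =
      Complex.I⁻¹ * ∮ z in C(0, 1), h z := by
  rw [circleIntegral, ← intervalIntegral.integral_const_mul]
  congr 1
  ext θ
  rw [deriv_circleMap, smul_eq_mul]
  field_simp [Complex.I_ne_zero]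

lemma norm_circleMap_zero_one (θ : ℝ) : ‖circleMap 0 1 θ‖ = 1 := by simp

lemma differentiableOn_inv_one_sub_mul_conj {w : ℂ} (hw : ‖w‖ < 1) :
    DifferentiableOn ℂ (fun z ↦ (1 - z * conj w)⁻¹) (closedBall 0 1) := by
  refine DifferentiableOn.inv (by fun_prop) fun z hz ↦ ?_
  exact one_sub_mul_conj_ne_zero hw (by simpa using hz)

lemma integral_conj_complexMT_mul_self {α : ℕ → ℂ} (hα : ∀ k, ‖α k‖ < 1) (n : ℕ) :
    ∫ θ in (0 : ℝ)..(2 * π),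
      conj (complexMT α n (circleMap 0 1 θ)) * complexMT α n (circleMap 0 1 θ) = 2 * π := by
  have hpos : 0 < 1 - ‖α n‖ ^ 2 := by nlinarith [norm_nonneg (α n), hα n]
  have hsq : (Real.sqrt (1 - ‖α n‖ ^ 2) : ℂ) * Real.sqrt (1 - ‖α n‖ ^ 2) =
      1 - α n * conj (α n) := by
    rw [← Complex.ofReal_mul, Real.mul_self_sqrt hpos.le, Complex.mul_conj,
      Complex.normSq_eq_norm_sq]
    push_cast
    rfl
  have hint (z : ℂ) (hz : ‖z‖ = 1) : conj (complexMT α n z) * complexMT α n z =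
      z * ((z - α n)⁻¹ • ((1 - α n * conj (α n)) * (1 - z * conj (α n))⁻¹)) := by
    have hprod : conj (∏ k ∈ Finset.range n, (1 - z * conj (α k))⁻¹ * (z - α k)) *
        (∏ k ∈ Finset.range n, (1 - z * conj (α k))⁻¹ * (z - α k)) = 1 := by
      rw [map_prod, ← Finset.prod_mul_distrib]
      exact Finset.prod_eq_one fun k _ ↦ conj_blaschke_mul_self (hα k) hz
    rw [complexMT, map_mul, map_mul, Complex.conj_ofReal, conj_inv_one_sub_mul_conj (hα n) hz,
      smul_eq_mul, ← hsq]
    linear_combination (Real.sqrt (1 - ‖α n‖ ^ 2) : ℂ) * Real.sqrt (1 - ‖α n‖ ^ 2) *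
      (z * (z - α n)⁻¹) * (1 - z * conj (α n))⁻¹ * hprod
  simp_rw [fun θ ↦ hint _ (norm_circleMap_zero_one θ)]
  rw [integral_mul_circleMap_eq_circleIntegral
    (fun z ↦ (z - α n)⁻¹ • ((1 - α n * conj (α n)) * (1 - z * conj (α n))⁻¹)),
    DifferentiableOn.circleIntegral_sub_inv_smul
      ((differentiableOn_inv_one_sub_mul_conj (hα n)).const_mul _) (by simpa using hα n),
    mul_inv_cancel₀ (one_sub_mul_conj_ne_zero (hα n) (hα n).le), smul_eq_mul]
  field_simp [Complex.I_ne_zero]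

lemma integral_conj_complexMT_mul_of_lt {α : ℕ → ℂ} (hα : ∀ k, ‖α k‖ < 1) {m n : ℕ}
    (hmn : m < n) :
    ∫ θ in (0 : ℝ)..(2 * π),
      conj (complexMT α m (circleMap 0 1 θ)) * complexMT α n (circleMap 0 1 θ) = 0 := by
  set h : ℂ → ℂ := fun z ↦
    (Real.sqrt (1 - ‖α m‖ ^ 2) : ℂ) * Real.sqrt (1 - ‖α n‖ ^ 2) * (1 - z * conj (α m))⁻¹ *
      (∏ k ∈ Finset.Ico (m + 1) n, (1 - z * conj (α k))⁻¹ * (z - α k)) *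
      (1 - z * conj (α n))⁻¹ with hh
  have hint (z : ℂ) (hz : ‖z‖ = 1) : conj (complexMT α m z) * complexMT α n z = z * h z := by
    have hprod : conj (∏ k ∈ Finset.range m, (1 - z * conj (α k))⁻¹ * (z - α k)) *
        (∏ k ∈ Finset.range m, (1 - z * conj (α k))⁻¹ * (z - α k)) = 1 := by
      rw [map_prod, ← Finset.prod_mul_distrib]
      exact Finset.prod_eq_one fun k _ ↦ conj_blaschke_mul_self (hα k) hz
    have hcancel := inv_mul_cancel₀ (sub_ne_zero_of_norm_lt_one (hα m) hz)
    rw [complexMT, complexMT, map_mul, map_mul, Complex.conj_ofReal,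
      conj_inv_one_sub_mul_conj (hα m) hz, ← Finset.prod_range_mul_prod_Ico _ hmn,
      Finset.prod_range_succ, hh]
    set P := ∏ k ∈ Finset.range m, (1 - z * conj (α k))⁻¹ * (z - α k)
    set Q := ∏ k ∈ Finset.Ico (m + 1) n, (1 - z * conj (α k))⁻¹ * (z - α k)
    set s := (Real.sqrt (1 - ‖α m‖ ^ 2) : ℂ)
    set t := (Real.sqrt (1 - ‖α n‖ ^ 2) : ℂ)
    set u := (1 - z * conj (α m))⁻¹
    set v := (1 - z * conj (α n))⁻¹
    linear_combination s * t * z * u * Q * v * ((z - α m)⁻¹ * (z - α m)) * hprod +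
      s * t * z * u * Q * v * hcancel
  have hd : DifferentiableOn ℂ h (closedBall 0 1) := by
    refine ((((differentiableOn_inv_one_sub_mul_conj (hα m)).const_mul _).mul ?_).mul
      (differentiableOn_inv_one_sub_mul_conj (hα n)))
    refine DifferentiableOn.fun_finsetProd fun k _ ↦ ?_
    exact (differentiableOn_inv_one_sub_mul_conj (hα k)).mul (by fun_prop)
  simp_rw [fun θ ↦ hint _ (norm_circleMap_zero_one θ)]
  rw [integral_mul_circleMap_eq_circleIntegral,
    (hd.mono closure_ball_subset_closedBall).diffContOnCl.circleIntegral_eq_zero zero_le_one,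
    mul_zero]

theorem integral_conj_complexMT_mul {α : ℕ → ℂ} (hα : ∀ k, ‖α k‖ < 1) (m n : ℕ) :
    ∫ θ in (0 : ℝ)..(2 * π),
      conj (complexMT α m (circleMap 0 1 θ)) * complexMT α n (circleMap 0 1 θ) =
        (if m = n then 2 * π else 0 : ℂ) := by
  rcases lt_trichotomy m n with hmn | rfl | hmn
  · rw [integral_conj_complexMT_mul_of_lt hα hmn, if_neg hmn.ne]
  · rw [integral_conj_complexMT_mul_self hα, if_pos rfl]
  · have := congrArg conj (integral_conj_complexMT_mul_of_lt hα hmn)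
    rw [← intervalIntegral.intervalIntegral_conj] at this
    simpa [hmn.ne', mul_comm] using this

end Complex

section Slice

open ComplexConjugate

variable {I : Quaternion ℝ}

lemma star_eq_neg_of_mul_self (hI : I * I = -1) : star I = -I := by
  have hnorm : ‖I‖ * ‖I‖ = 1 := by rw [← norm_mul, hI, norm_neg, norm_one]
  have hstar : star I * I = 1 := by
    rw [Quaternion.star_mul_self, Quaternion.normSq_eq_norm_mul_self, hnorm, Quaternion.coe_one]
  calc star I = -(star I * (I * I)) := by rw [hI, mul_neg_one, neg_neg]
    _ = -I := by rw [← mul_assoc, hstar, one_mul]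

lemma liftAux_conj (hI : I * I = -1) (z : ℂ) :
    Complex.liftAux I hI (conj z) = star (Complex.liftAux I hI z) := by
  simp [Complex.liftAux_apply, star_eq_neg_of_mul_self hI, Quaternion.algebraMap_def]

lemma norm_liftAux (hI : I * I = -1) (z : ℂ) : ‖Complex.liftAux I hI z‖ = ‖z‖ := by
  have h : ((Quaternion.normSq (Complex.liftAux I hI z) : ℝ) : Quaternion ℝ) =
      ((Complex.normSq z : ℝ) : Quaternion ℝ) := by
    rw [← Quaternion.self_mul_star, ← liftAux_conj, ← map_mul, Complex.mul_conj]
    exact (Complex.liftAux I hI).commutes _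
  rw [Quaternion.coe_inj, Quaternion.normSq_eq_norm_mul_self, Complex.normSq_eq_norm_sq,
    ← sq] at h
  exact (pow_left_inj₀ (norm_nonneg _) (norm_nonneg _) two_ne_zero).mp h

/-- The embedding of `ℂ` onto the slice of the imaginary unit `I`, as a linear isometry. -/
def sliceIsometry (hI : I * I = -1) : ℂ →ₗᵢ[ℝ] Quaternion ℝ where
  toLinearMap := (Complex.liftAux I hI).toLinearMap
  norm_map' := norm_liftAux hI

lemma liftAux_ofReal (hI : I * I = -1) (r : ℝ) :
    Complex.liftAux I hI (r : ℂ) = (r : Quaternion ℝ) :=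
  (Complex.liftAux I hI).commutes r

lemma expI_eq_liftAux (hI : I * I = -1) (θ : ℝ) :
    expI I θ = Complex.liftAux I hI (circleMap 0 1 θ) := by
  simp [expI, Complex.liftAux_apply, circleMap, Complex.exp_ofReal_mul_I_re,
    Complex.exp_ofReal_mul_I_im, Quaternion.algebraMap_def]

lemma Phi_succ_liftAux (hI : I * I = -1) {a : ℕ → Quaternion ℝ} {α : ℕ → ℂ}
    (haα : ∀ k, a (k + 1) = Complex.liftAux I hI (α k)) (n : ℕ) (z : ℂ) :
    Phi a (n + 1) (Complex.liftAux I hI z) = Complex.liftAux I hI (complexMT α n z) := by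
  have hlist : ((List.range n).map fun k ↦ B (a (k + 1)) (Complex.liftAux I hI z)).prod =
      Complex.liftAux I hI (∏ k ∈ Finset.range n, (1 - z * conj (α k))⁻¹ * (z - α k)) := by
    induction n with
    | zero => simp
    | succ n ih =>
      rw [List.range_succ, List.map_append, List.prod_append, ih, Finset.prod_range_succ]
      simp only [List.map_cons, List.map_nil, List.prod_singleton, B, haα, map_mul, map_inv₀,
        map_sub, map_one, liftAux_conj]
  rw [Phi, Nat.add_sub_cancel, hlist, haα, norm_liftAux, complexMT]
  simp only [map_mul, map_inv₀, map_sub, map_one, liftAux_conj, liftAux_ofReal]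

end Slice

/-- **Theorem 4.1** (orthonormality of the slice regular Malmquist–Takenaka system):
if all parameters `a_n` lie on one slice `L_I` and `‖a_n‖ < 1`, then the
Malmquist–Takenaka functions are orthonormal with respect to the boundary inner
product on the slice. -/
theorem MT_orthonormal_on_slice
    (I : Quaternion ℝ) (hI : I ^ 2 = -1)
    (a : ℕ → Quaternion ℝ)
    (ha_slice : ∀ n, 1 ≤ n → ∃ x y : ℝ, a n = (x : Quaternion ℝ) + y • I)
    (ha_norm : ∀ n, 1 ≤ n → ‖a n‖ < 1)
    (m n : ℕ) (hm : 1 ≤ m) (hn : 1 ≤ n) :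
    (1 / (2 * π)) • ∫ θ in (0:ℝ)..(2 * π),
        star (Phi a m (expI I θ)) * Phi a n (expI I θ) =
      if m = n then 1 else 0 := by
  have hI' : I * I = -1 := by rw [← sq, hI]
  have hα (k : ℕ) : ∃ w : ℂ, a (k + 1) = Complex.liftAux I hI' w := by
    obtain ⟨x, y, h⟩ := ha_slice (k + 1) k.succ_pos
    exact ⟨⟨x, y⟩, by rw [h, Complex.liftAux_apply, Quaternion.algebraMap_def]⟩
  choose α haα using hα
  have hnorm (k : ℕ) : ‖α k‖ < 1 := by
    rw [← norm_liftAux hI', ← haα]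
    exact ha_norm _ k.succ_pos
  obtain ⟨m, rfl⟩ := Nat.exists_eq_add_of_le' hm
  obtain ⟨n, rfl⟩ := Nat.exists_eq_add_of_le' hn
  have hint (θ : ℝ) : star (Phi a (m + 1) (expI I θ)) * Phi a (n + 1) (expI I θ) =
      sliceIsometry hI' (star (complexMT α m (circleMap 0 1 θ)) *
        complexMT α n (circleMap 0 1 θ)) := by
    rw [expI_eq_liftAux hI', Phi_succ_liftAux hI' haα, Phi_succ_liftAux hI' haα, ← liftAux_conj,
      ← map_mul]
    rfl
  have hcomplex := integral_conj_complexMT_mul hnorm m n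
  simp only [starRingEnd_apply] at hcomplex
  simp_rw [hint]
  rw [LinearIsometry.intervalIntegral_comp_comm, hcomplex, ← map_smul]
  have hone : sliceIsometry hI' 1 = 1 := map_one (Complex.liftAux I hI')
  have hπ : (π : ℂ) ≠ 0 := Complex.ofReal_ne_zero.mpr Real.pi_ne_zero
  by_cases hmn : m = n
  · have : (1 / (2 * π)) • (2 * π : ℂ) = 1 := by
      rw [Complex.real_smul]
      push_cast
      field_simp
    rw [if_pos hmn, if_pos (by rw [hmn]), this, hone]
  · rw [if_neg hmn, if_neg (by simpa using hmn), smul_zero, map_zero]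
end
end

section
/- Let I ∈ ℍ be an imaginary unit and let (a_n)_{n≥1} be a sequence on the slice L_I with ‖a_n‖ < 1 for all n and satisfying the non-Blaschke condition ∑_{n≥1} (1 - ‖a_n‖) = +∞. Let c : ℕ → ℍ satisfy ∑_{n≥0} ‖c_n‖² < ∞ and define f : 𝔹 → ℍ by the convergent power series f(q) = ∑_{n≥0} qⁿ·c_n. If for every k ≥ 1 one has lim_{r→1⁻} (1/(2π))·∫₀^{2π} conj(Φ_k(r·e^{Iθ}))·f(r·e^{Iθ}) dθ = 0, then c_n = 0 for all n, i.e., f is identically zero. (This is Theorem 4.2: completeness of the slice regular Malmquist–Takenaka system in the quaternionic Hardy space H²(𝔹), whose elements are exactly such power series with square-summable coefficients and whose inner product ⟨f, Φ_k⟩ equals the stated boundary limit.) -/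
open scoped Real
noncomputable section

/-- The model `ℓ²(ℕ, ℂ)` of the complex Hardy space of the disc. -/
abbrev HardySeq : Type := lp (fun _ : ℕ => ℂ) 2

theorem memℓp_two_iff_summable_sq {E : Type*} [NormedAddCommGroup E] (x : ℕ → E) :
    Memℓp x 2 ↔ Summable fun n => ‖x n‖ ^ 2 := by
  rw [memℓp_gen_iff (by norm_num)]
  simp

theorem HardySeq.summable_sq (x : HardySeq) : Summable fun n => ‖x n‖ ^ 2 :=
  (memℓp_two_iff_summable_sq _).1 x.2

theorem HardySeq.norm_sq_eq_tsum (x : HardySeq) : ‖x‖ ^ 2 = ∑' n, ‖x n‖ ^ 2 := by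
  simpa using lp.norm_rpow_eq_tsum (p := 2) (by norm_num) x

/-- Prepending a zero to a sequence. -/
def shiftSeq (x : ℕ → ℂ) : ℕ → ℂ
  | 0 => 0
  | n + 1 => x n

theorem summable_sq_shiftSeq {x : ℕ → ℂ} (hx : Summable fun n => ‖x n‖ ^ 2) :
    Summable fun n => ‖shiftSeq x n‖ ^ 2 := by
  rw [← summable_nat_add_iff 1]
  exact hx

theorem tsum_sq_shiftSeq {x : ℕ → ℂ} (hx : Summable fun n => ‖x n‖ ^ 2) :
    ∑' n, ‖shiftSeq x n‖ ^ 2 = ∑' n, ‖x n‖ ^ 2 := by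
  rw [(summable_sq_shiftSeq hx).tsum_eq_zero_add]
  simp [shiftSeq]

/-- The unilateral shift, i.e. multiplication by the variable. -/
def hardyShift : HardySeq →ₗᵢ[ℂ] HardySeq where
  toFun x := ⟨shiftSeq x, (memℓp_two_iff_summable_sq _).2 (summable_sq_shiftSeq x.summable_sq)⟩
  map_add' x y := lp.ext <| funext fun n => by
    cases n with
    | zero => exact (add_zero (0 : ℂ)).symm
    | succ n => rfl
  map_smul' c x := by ext n; cases n <;> simp [shiftSeq]
  norm_map' x := by
    rw [← sq_eq_sq₀ (norm_nonneg _) (norm_nonneg _), HardySeq.norm_sq_eq_tsum,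
      HardySeq.norm_sq_eq_tsum]
    exact tsum_sq_shiftSeq x.summable_sq

@[simp]
theorem hardyShift_zero (x : HardySeq) : hardyShift x 0 = 0 := rfl

@[simp]
theorem hardyShift_succ (x : HardySeq) (n : ℕ) : hardyShift x (n + 1) = x n := rfl

theorem hardyShift_single (n : ℕ) :
    hardyShift (lp.single 2 n (1 : ℂ)) = lp.single 2 (n + 1) (1 : ℂ) := by
  ext m
  cases m with
  | zero => simp [lp.single_apply]
  | succ m => simp [lp.single_apply, Pi.single_apply]

theorem summable_geometric_sq {z : ℂ} (hz : ‖z‖ < 1) :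
    Summable fun n : ℕ => ‖(starRingEnd ℂ z) ^ n‖ ^ 2 := by
  have : ∀ n : ℕ, ‖(starRingEnd ℂ z) ^ n‖ ^ 2 = (‖z‖ ^ 2) ^ n := fun n => by
    rw [norm_pow, RCLike.norm_conj]; ring
  simp_rw [this]
  exact summable_geometric_of_lt_one (by positivity) (by nlinarith [norm_nonneg z])

/-- The Szegő kernel at a point of the unit disc. -/
def szegoKernel (z : ℂ) (hz : ‖z‖ < 1) : HardySeq :=
  ⟨fun n => (starRingEnd ℂ z) ^ n, (memℓp_two_iff_summable_sq _).2 (summable_geometric_sq hz)⟩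

theorem szegoKernel_apply {z : ℂ} (hz : ‖z‖ < 1) (n : ℕ) :
    szegoKernel z hz n = (starRingEnd ℂ z) ^ n := rfl

/-- The value at `z` of the power series with coefficients `x`. -/
def hardyEval (z : ℂ) (x : HardySeq) : ℂ := ∑' n, z ^ n * x n

theorem hardyEval_eq_inner {z : ℂ} (hz : ‖z‖ < 1) (x : HardySeq) :
    hardyEval z x = inner ℂ (szegoKernel z hz) x := by
  rw [lp.inner_eq_tsum]
  exact tsum_congr fun n => by simp [szegoKernel_apply, mul_comm]

theorem hardyEval_summable {z : ℂ} (hz : ‖z‖ < 1) (x : HardySeq) :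
    Summable fun n => z ^ n * x n := by
  refine (lp.summable_inner (𝕜 := ℂ) (szegoKernel z hz) x).congr fun n => ?_
  simp [szegoKernel_apply, mul_comm]

theorem hardyEval_shift {z : ℂ} (hz : ‖z‖ < 1) (x : HardySeq) :
    hardyEval z (hardyShift x) = z * hardyEval z x := by
  rw [hardyEval, (hardyEval_summable hz _).tsum_eq_zero_add, hardyEval, ← tsum_mul_left]
  simp [pow_succ', mul_assoc]

theorem hardyEval_sub {z : ℂ} (hz : ‖z‖ < 1) (x y : HardySeq) :
    hardyEval z (x - y) = hardyEval z x - hardyEval z y := by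
  simp only [hardyEval_eq_inner hz, inner_sub_right]

theorem hardyEval_smul {z : ℂ} (hz : ‖z‖ < 1) (c : ℂ) (x : HardySeq) :
    hardyEval z (c • x) = c * hardyEval z x := by
  simp only [hardyEval_eq_inner hz, inner_smul_right]

theorem one_sub_mul_conj_ne_zero_s1 {α z : ℂ} (hα : ‖α‖ < 1) (hz : ‖z‖ < 1) :
    1 - z * starRingEnd ℂ α ≠ 0 := by
  intro h
  have h1 : ‖z * starRingEnd ℂ α‖ = 1 := by rw [← sub_eq_zero.1 h, norm_one]
  rw [norm_mul, RCLike.norm_conj] at h1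
  nlinarith [norm_nonneg z, norm_nonneg α]

theorem hardyEval_szegoKernel {α z : ℂ} (hα : ‖α‖ < 1) (hz : ‖z‖ < 1) :
    hardyEval z (szegoKernel α hα) = (1 - z * starRingEnd ℂ α)⁻¹ := by
  simp_rw [hardyEval, szegoKernel_apply, ← mul_pow]
  refine tsum_geometric_of_norm_lt_one ?_
  rw [norm_mul, RCLike.norm_conj]
  nlinarith [norm_nonneg z, norm_nonneg α]

/-- The complex Blaschke factor. -/
def complexBlaschke (α z : ℂ) : ℂ := (1 - z * starRingEnd ℂ α)⁻¹ * (z - α)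

/-- Multiplication by a Blaschke factor is an isometry whose range consists of the functions
vanishing at the zero of the factor. -/
theorem exists_blaschke_isometry {α : ℂ} (hα : ‖α‖ < 1) :
    ∃ V : HardySeq →ₗᵢ[ℂ] HardySeq,
      (∀ z, ‖z‖ < 1 → ∀ x, hardyEval z (V x) = complexBlaschke α z * hardyEval z x) ∧
      ∀ u, hardyEval α u = 0 → ∃ x, V x = u := by
  set S : HardySeq →L[ℂ] HardySeq := hardyShift.toContinuousLinearMap
  have hnS : ‖(starRingEnd ℂ α) • S‖ < 1 := by
    rw [norm_smul, RCLike.norm_conj]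
    have := hardyShift.norm_toContinuousLinearMap_le
    nlinarith [norm_nonneg α]
  obtain ⟨U, hU⟩ := isUnit_one_sub_of_norm_lt_one hnS
  have hUx : ∀ x, x = (U⁻¹.1 x) - (starRingEnd ℂ α) • hardyShift (U⁻¹.1 x) := fun x => by
    have h : (U.1 * U⁻¹.1) x = x := by rw [Units.mul_inv]; rfl
    rw [hU] at h
    exact h.symm
  have hUx' : ∀ x, U⁻¹.1 (x - (starRingEnd ℂ α) • hardyShift x) = x := fun x => by
    have h : (U⁻¹.1 * U.1) x = x := by rw [Units.inv_mul]; rfl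
    rw [hU] at h
    exact h
  have hiso : ∀ y : HardySeq,
      ‖hardyShift y - α • y‖ = ‖y - (starRingEnd ℂ α) • hardyShift y‖ := fun y => by
    rw [← sq_eq_sq₀ (norm_nonneg _) (norm_nonneg _), @norm_sub_sq ℂ, @norm_sub_sq ℂ]
    simp only [norm_smul, hardyShift.norm_map, inner_smul_right, RCLike.norm_conj]
    have : RCLike.re ((starRingEnd ℂ α) * inner ℂ y (hardyShift y)) =
        RCLike.re (α * inner ℂ (hardyShift y) y) := by
      rw [← inner_conj_symm (𝕜 := ℂ) y, ← map_mul, RCLike.conj_re]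
    rw [this]
  let V : HardySeq →ₗᵢ[ℂ] HardySeq :=
    { toLinearMap := ((S - α • 1) * U⁻¹.1 : HardySeq →L[ℂ] HardySeq)
      norm_map' := fun x => by
        conv_rhs => rw [hUx x, ← hiso]
        rfl }
  have hV : ∀ x, V x = hardyShift (U⁻¹.1 x) - α • U⁻¹.1 x := fun _ => rfl
  refine ⟨V, fun z hz x => ?_, fun u hu => ?_⟩
  · have h1 : hardyEval z x = (1 - z * starRingEnd ℂ α) * hardyEval z (U⁻¹.1 x) := by
      conv_lhs => rw [hUx x, hardyEval_sub hz, hardyEval_smul hz, hardyEval_shift hz]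
      ring
    rw [hV, hardyEval_sub hz, hardyEval_smul hz, hardyEval_shift hz, h1, complexBlaschke]
    have := one_sub_mul_conj_ne_zero_s1 hα hz
    field_simp
  · have hcl : IsClosed (LinearMap.range V.toLinearMap : Set HardySeq) := by
      rw [LinearMap.coe_range]
      exact V.isometry.isClosedEmbedding.isClosed_range
    suffices hmem : u ∈ LinearMap.range V.toLinearMap by
      obtain ⟨x, hx⟩ := hmem
      exact ⟨x, hx⟩
    rw [← hcl.submodule_topologicalClosure_eq, ← Submodule.orthogonal_orthogonal_eq_closure,
      Submodule.mem_orthogonal]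
    intro y hy
    rw [Submodule.mem_orthogonal'] at hy
    have hstep : ∀ n, y (n + 1) = starRingEnd ℂ α * y n := fun n => by
      have h := hy (V (lp.single 2 n 1 - (starRingEnd ℂ α) • hardyShift (lp.single 2 n 1)))
        ⟨_, rfl⟩
      rw [hV, hUx', hardyShift_single, inner_sub_right, inner_smul_right,
        lp.inner_single_right, lp.inner_single_right] at h
      have h' := congrArg (starRingEnd ℂ) h
      simpa [sub_eq_zero] using h'
    have hy0 : y = (y 0) • szegoKernel α hα := by
      ext n
      rw [lp.coeFn_smul, Pi.smul_apply, szegoKernel_apply]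
      induction n with
      | zero => simp
      | succ n ih => rw [hstep, ih, smul_eq_mul, smul_eq_mul]; ring
    rw [hy0, inner_smul_left, ← hardyEval_eq_inner hα, hu, mul_zero]

theorem norm_complexBlaschke_le_exp {α z : ℂ} (hα : ‖α‖ < 1) (hz : ‖z‖ < 1) :
    ‖complexBlaschke α z‖ ≤ Real.exp (-((1 - ‖z‖ ^ 2) / 8 * (1 - ‖α‖))) := by
  have hne := one_sub_mul_conj_ne_zero_s1 hα hz
  have hd : 0 < ‖1 - z * starRingEnd ℂ α‖ := norm_pos_iff.2 hne
  have hd2 : ‖1 - z * starRingEnd ℂ α‖ ≤ 2 := by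
    refine (norm_sub_le _ _).trans ?_
    rw [norm_mul, RCLike.norm_conj, norm_one]
    nlinarith [norm_nonneg z, norm_nonneg α]
  have key : ‖1 - z * starRingEnd ℂ α‖ ^ 2 - ‖z - α‖ ^ 2 = (1 - ‖z‖ ^ 2) * (1 - ‖α‖ ^ 2) := by
    simp only [← Complex.normSq_eq_norm_sq, Complex.normSq_apply]
    simp
    ring
  set t := (1 - ‖z‖ ^ 2) / 8 * (1 - ‖α‖) with ht
  have hz2 : 0 < 1 - ‖z‖ ^ 2 := by nlinarith [norm_nonneg z]
  have hb : ‖complexBlaschke α z‖ ^ 2 ≤ 1 - 2 * t := by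
    rw [complexBlaschke, norm_mul, norm_inv, mul_pow, inv_pow, inv_mul_le_iff₀ (by positivity)]
    have h4 : ‖1 - z * starRingEnd ℂ α‖ ^ 2 ≤ 4 := by nlinarith
    have ht0 : 0 ≤ t := mul_nonneg (by positivity) (by linarith)
    have h5 : 8 * t ≤ (1 - ‖z‖ ^ 2) * (1 - ‖α‖ ^ 2) := by
      have : 1 - ‖α‖ ≤ 1 - ‖α‖ ^ 2 := by nlinarith [norm_nonneg α]
      nlinarith
    nlinarith
  rw [← pow_le_pow_iff_left₀ (norm_nonneg _) (Real.exp_pos _).le two_ne_zero, ← Real.exp_nat_mul]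
  refine hb.trans ?_
  have := Real.add_one_le_exp (((2 : ℕ) : ℝ) * -t)
  push_cast at this ⊢
  linarith

theorem tendsto_prod_complexBlaschke {α : ℕ → ℂ} (hα : ∀ n, ‖α n‖ < 1)
    (hns : ¬ Summable fun n => 1 - ‖α n‖) {z : ℂ} (hz : ‖z‖ < 1) :
    Filter.Tendsto (fun n => ∏ j ∈ Finset.range n, complexBlaschke (α j) z)
      Filter.atTop (nhds 0) := by
  rw [not_summable_iff_tendsto_nat_atTop_of_nonneg fun n => by linarith [hα n]] at hns
  have hz2 : 0 < (1 - ‖z‖ ^ 2) / 8 := by nlinarith [norm_nonneg z]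
  refine squeeze_zero_norm (a := fun n =>
    Real.exp (-((1 - ‖z‖ ^ 2) / 8 * ∑ j ∈ Finset.range n, (1 - ‖α j‖)))) (fun n => ?_) ?_
  · rw [norm_prod, Finset.mul_sum, ← Finset.sum_neg_distrib, Real.exp_sum]
    exact Finset.prod_le_prod (fun _ _ => norm_nonneg _)
      fun j _ => norm_complexBlaschke_le_exp (hα j) hz
  · exact Real.tendsto_exp_neg_atTop_nhds_zero.comp (hns.const_mul_atTop hz2)

/-- Completeness of the complex Malmquist–Takenaka system in the sequence model. -/
theorem exists_malmquistTakenaka_complete {α : ℕ → ℂ} (hα : ∀ n, ‖α n‖ < 1)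
    (hns : ¬ Summable fun n => 1 - ‖α n‖) :
    ∃ p : ℕ → HardySeq,
      (∀ k z, ‖z‖ < 1 → hardyEval z (p k) =
        (∏ j ∈ Finset.range k, complexBlaschke (α j) z) * (1 - z * starRingEnd ℂ (α k))⁻¹) ∧
      ∀ u, (∀ k, inner ℂ (p k) u = 0) → ∀ z, ‖z‖ < 1 → hardyEval z u = 0 := by
  choose V hV hVr using fun n => exists_blaschke_isometry (hα n)
  let W : ℕ → HardySeq →ₗᵢ[ℂ] HardySeq :=
    fun n => Nat.rec LinearIsometry.id (fun m w => w.comp (V m)) n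
  have hWs : ∀ n x, W (n + 1) x = W n (V n x) := fun _ _ => rfl
  have hW : ∀ n z, ‖z‖ < 1 → ∀ x, hardyEval z (W n x) =
      (∏ j ∈ Finset.range n, complexBlaschke (α j) z) * hardyEval z x := by
    intro n z hz
    induction n with
    | zero => intro x; simp [W]
    | succ n ih => intro x; rw [hWs, ih, hV n z hz, Finset.prod_range_succ]; ring
  refine ⟨fun k => W k (szegoKernel (α k) (hα k)), fun k z hz => ?_, fun u hu z hz => ?_⟩
  · rw [hW k z hz, hardyEval_szegoKernel (hα k) hz]
  · have hr : ∀ n, ∃ x, W n x = u := by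
      intro n
      induction n with
      | zero => exact ⟨u, rfl⟩
      | succ n ih =>
        obtain ⟨x, rfl⟩ := ih
        have h := hu n
        rw [LinearIsometry.inner_map_map, ← hardyEval_eq_inner (hα n)] at h
        obtain ⟨y, rfl⟩ := hVr n x h
        exact ⟨y, rfl⟩
    choose x hx using hr
    have hlim : Filter.Tendsto
        (fun n => (∏ j ∈ Finset.range n, complexBlaschke (α j) z) * hardyEval z (x n))
        Filter.atTop (nhds 0) := by
      refine Filter.Tendsto.zero_mul_isBoundedUnder_le (tendsto_prod_complexBlaschke hα hns hz) ?_
      refine Filter.isBoundedUnder_of ⟨‖szegoKernel z hz‖ * ‖u‖, fun n => ?_⟩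
      rw [Function.comp_apply, hardyEval_eq_inner hz, ← hx n, LinearIsometry.norm_map]
      exact norm_inner_le_norm _ _
    have hconst : ∀ n, (∏ j ∈ Finset.range n, complexBlaschke (α j) z) * hardyEval z (x n) =
        hardyEval z u := fun n => by rw [← hW n z hz, hx]
    simp_rw [hconst] at hlim
    exact tendsto_nhds_unique tendsto_const_nhds hlim

theorem summable_pow_mul_norm {E : Type*} [NormedAddCommGroup E] {c : ℕ → E}
    (hc : Summable fun n => ‖c n‖ ^ 2) {r : ℝ} (hr0 : 0 ≤ r) (hr : r < 1) :
    Summable fun n => r ^ n * ‖c n‖ := by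
  have hg : Summable fun n : ℕ => (r ^ 2) ^ n :=
    summable_geometric_of_lt_one (by positivity) (by nlinarith)
  refine Summable.of_nonneg_of_le (fun n => by positivity) (fun n => ?_) (hg.add hc)
  have : (r ^ 2) ^ n = (r ^ n) ^ 2 := by ring
  rw [this]
  nlinarith [sq_nonneg (r ^ n - ‖c n‖), sq_nonneg (r ^ n), sq_nonneg ‖c n‖]

theorem continuous_tsum_pow_mul {E : Type*} [NormedDivisionRing E] [CompleteSpace E] {c : ℕ → E}
    (hc : Summable fun n => ‖c n‖ ^ 2) {r : ℝ} (hr0 : 0 ≤ r) (hr : r < 1) {g : ℝ → E}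
    (hg : Continuous g) (hgr : ∀ θ, ‖g θ‖ = r) : Continuous fun θ => ∑' n, g θ ^ n * c n := by
  refine continuous_tsum (fun n => by fun_prop) (summable_pow_mul_norm hc hr0 hr) fun n θ => ?_
  rw [norm_mul, norm_pow, hgr]

theorem norm_ofReal_mul_exp {r : ℝ} (hr0 : 0 ≤ r) (θ : ℝ) :
    ‖(r : ℂ) * Complex.exp (θ * Complex.I)‖ = r := by
  rw [norm_mul, Complex.norm_exp_ofReal_mul_I, mul_one, Complex.norm_real, Real.norm_of_nonneg hr0]

theorem continuous_hardyEval_circle {r : ℝ} (hr0 : 0 ≤ r) (hr : r < 1) (x : HardySeq) :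
    Continuous fun θ : ℝ => hardyEval (r * Complex.exp (θ * Complex.I)) x :=
  continuous_tsum_pow_mul x.summable_sq hr0 hr (by fun_prop) (norm_ofReal_mul_exp hr0)

theorem hasSum_integral_mul_hardyEval {r : ℝ} (hr0 : 0 ≤ r) (hr : r < 1) (x : HardySeq)
    {g : ℝ → ℂ} (hg : Continuous g) :
    HasSum (fun n => ∫ θ in (0 : ℝ)..(2 * π), g θ * ((r * Complex.exp (θ * Complex.I)) ^ n * x n))
      (∫ θ in (0 : ℝ)..(2 * π), g θ * hardyEval (r * Complex.exp (θ * Complex.I)) x) := by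
  obtain ⟨C, hC⟩ := isCompact_uIcc (a := (0 : ℝ)) (b := 2 * π) |>.exists_bound_of_continuousOn
    hg.continuousOn
  have hs := summable_pow_mul_norm x.summable_sq hr0 hr
  refine intervalIntegral.hasSum_integral_of_dominated_convergence
    (fun n _ => C * (r ^ n * ‖x n‖)) (fun n => ?_) (fun n => ?_) ?_ ?_ ?_
  · exact Continuous.aestronglyMeasurable (by fun_prop)
  · refine Filter.Eventually.of_forall fun θ hθ => ?_
    rw [norm_mul, norm_mul, norm_pow, norm_ofReal_mul_exp hr0]
    exact mul_le_mul_of_nonneg_right (hC θ (Set.uIoc_subset_uIcc hθ)) (by positivity)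
  · exact Filter.Eventually.of_forall fun θ _ => hs.mul_left C
  · exact intervalIntegrable_const
  · refine Filter.Eventually.of_forall fun θ _ => ?_
    refine ((hardyEval_summable ?_ x).hasSum).mul_left _
    rwa [norm_ofReal_mul_exp hr0]

theorem integral_exp_conj_mul_exp (m n : ℕ) :
    ∫ θ in (0 : ℝ)..(2 * π), Complex.exp (θ * Complex.I) ^ m *
      starRingEnd ℂ (Complex.exp (θ * Complex.I) ^ n) = if m = n then 2 * π else 0 := by
  have h : ∀ θ : ℝ, Complex.exp (θ * Complex.I) ^ m *
      starRingEnd ℂ (Complex.exp (θ * Complex.I) ^ n) =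
      Complex.exp ((((m : ℂ) - n) * Complex.I) * θ) := fun θ => by
    rw [map_pow, ← Complex.exp_conj, ← Complex.exp_nat_mul, ← Complex.exp_nat_mul,
      ← Complex.exp_add]
    congr 1
    simp
    ring
  simp_rw [h]
  split_ifs with hmn
  · subst hmn
    simp
  · have hne : ((m : ℂ) - n) * Complex.I ≠ 0 :=
      mul_ne_zero (sub_ne_zero.2 (by exact_mod_cast hmn)) Complex.I_ne_zero
    rw [integral_exp_mul_complex hne]
    have : ((m : ℂ) - n) * Complex.I * ((2 * π : ℝ) : ℂ) =
        ((m - n : ℤ) : ℂ) * (2 * π * Complex.I) := by push_cast; ring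
    rw [this, Complex.exp_int_mul_two_pi_mul_I]
    simp

theorem integral_conj_hardyEval_mul_pow {r : ℝ} (hr0 : 0 ≤ r) (hr : r < 1) (p : HardySeq)
    (n : ℕ) :
    ∫ θ in (0 : ℝ)..(2 * π), starRingEnd ℂ (hardyEval (r * Complex.exp (θ * Complex.I)) p) *
      (r * Complex.exp (θ * Complex.I)) ^ n = 2 * π * (r ^ (2 * n) * starRingEnd ℂ (p n)) := by
  have h := hasSum_integral_mul_hardyEval hr0 hr p
    (g := fun θ => starRingEnd ℂ ((r * Complex.exp (θ * Complex.I)) ^ n))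
    (Complex.continuous_conj.comp (by fun_prop))
  have hterm : ∀ m, ∫ θ in (0 : ℝ)..(2 * π), starRingEnd ℂ ((r * Complex.exp (θ * Complex.I)) ^ n) *
      ((r * Complex.exp (θ * Complex.I)) ^ m * p m) =
      if m = n then 2 * π * (r ^ (2 * n) * p n) else 0 := fun m => by
    have : ∀ θ : ℝ, starRingEnd ℂ ((r * Complex.exp (θ * Complex.I)) ^ n) *
      ((r * Complex.exp (θ * Complex.I)) ^ m * p m) = (r ^ n * r ^ m * p m) *
        (Complex.exp (θ * Complex.I) ^ m * starRingEnd ℂ (Complex.exp (θ * Complex.I) ^ n)) :=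
      fun θ => by
        simp only [map_pow, map_mul, mul_pow, Complex.conj_ofReal]
        ring
    simp_rw [this]
    rw [intervalIntegral.integral_const_mul, integral_exp_conj_mul_exp]
    split_ifs with hmn
    · subst hmn
      push_cast
      ring
    · simp
  simp_rw [hterm] at h
  have h2 := h.unique (hasSum_ite_eq n _)
  have h3 := congrArg (starRingEnd ℂ) h2
  rw [← intervalIntegral.intervalIntegral_conj] at h3
  simp only [map_mul, map_pow, Complex.conj_conj, Complex.conj_ofReal, Complex.conj_ofNat] at h3
  rw [← h3]
  refine intervalIntegral.integral_congr fun θ _ => ?_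
  simp only [mul_comm]

/-- The Hardy space pairing is the limit of the integral pairings on smaller circles. -/
theorem tendsto_integral_conj_hardyEval_mul (p u : HardySeq) :
    Filter.Tendsto (fun r : ℝ => (1 / (2 * π)) • ∫ θ in (0 : ℝ)..(2 * π),
        starRingEnd ℂ (hardyEval (r * Complex.exp (θ * Complex.I)) p) *
          hardyEval (r * Complex.exp (θ * Complex.I)) u)
      (nhdsWithin 1 (Set.Iio 1)) (nhds (inner ℂ p u)) := by
  have hev : ∀ᶠ r : ℝ in nhdsWithin 1 (Set.Iio 1), 0 ≤ r ∧ r < 1 := by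
    filter_upwards [self_mem_nhdsWithin, mem_nhdsWithin_of_mem_nhds (lt_mem_nhds one_pos)]
      with r h1 h0 using ⟨le_of_lt h0, h1⟩
  have heq : ∀ r : ℝ, 0 ≤ r → r < 1 → (1 / (2 * π)) • ∫ θ in (0 : ℝ)..(2 * π),
        starRingEnd ℂ (hardyEval (r * Complex.exp (θ * Complex.I)) p) *
          hardyEval (r * Complex.exp (θ * Complex.I)) u =
      ∑' n, (r : ℂ) ^ (2 * n) * (starRingEnd ℂ (p n) * u n) := by
    intro r hr0 hr
    have hs := hasSum_integral_mul_hardyEval hr0 hr u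
      (g := fun θ => starRingEnd ℂ (hardyEval (r * Complex.exp (θ * Complex.I)) p))
      (Complex.continuous_conj.comp (continuous_hardyEval_circle hr0 hr p))
    rw [← hs.tsum_eq, ← tsum_const_smul'']
    refine tsum_congr fun n => ?_
    simp_rw [← mul_assoc]
    rw [intervalIntegral.integral_mul_const, integral_conj_hardyEval_mul_pow hr0 hr,
      Complex.real_smul]
    have : (π : ℂ) ≠ 0 := by exact_mod_cast Real.pi_ne_zero
    push_cast
    field_simp
  have hin : inner ℂ p u = ∑' n, starRingEnd ℂ (p n) * u n := by
    rw [lp.inner_eq_tsum]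
    exact tsum_congr fun n => by simp [mul_comm]
  have hsum : Summable fun n => ‖starRingEnd ℂ (p n) * u n‖ := by
    refine ((lp.summable_inner (𝕜 := ℂ) p u).norm).congr fun n => ?_
    simp [mul_comm]
  rw [hin]
  refine Filter.Tendsto.congr' (hev.mono fun r hr => (heq r hr.1 hr.2).symm) ?_
  refine tendsto_tsum_of_dominated_convergence hsum (fun n => ?_)
    (hev.mono fun r hr n => ?_)
  · have hc : Continuous fun r : ℝ => (r : ℂ) ^ (2 * n) * (starRingEnd ℂ (p n) * u n) := by
      fun_prop
    have := (hc.tendsto 1).mono_left (nhdsWithin_le_nhds (s := Set.Iio 1))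
    simpa using this
  · rw [norm_mul, norm_pow, Complex.norm_real, Real.norm_of_nonneg hr.1]
    exact mul_le_of_le_one_left (norm_nonneg _) (pow_le_one₀ hr.1 hr.2.le)

theorem eq_zero_of_hardyEval_eq_zero {u : HardySeq} (hu : ∀ z, ‖z‖ < 1 → hardyEval z u = 0) :
    u = 0 := by
  have h := tendsto_integral_conj_hardyEval_mul u u
  have h0 : Filter.Tendsto (fun r : ℝ => (1 / (2 * π)) • ∫ θ in (0 : ℝ)..(2 * π),
        starRingEnd ℂ (hardyEval (r * Complex.exp (θ * Complex.I)) u) *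
          hardyEval (r * Complex.exp (θ * Complex.I)) u)
      (nhdsWithin 1 (Set.Iio 1)) (nhds 0) := by
    refine tendsto_const_nhds.congr' ?_
    filter_upwards [self_mem_nhdsWithin, mem_nhdsWithin_of_mem_nhds (lt_mem_nhds one_pos)]
      with r h1 h0
    have : ∀ θ : ℝ, hardyEval (r * Complex.exp (θ * Complex.I)) u = 0 := fun θ =>
      hu _ (by rw [norm_ofReal_mul_exp (le_of_lt h0)]; exact h1)
    simp [this]
  exact inner_self_eq_zero.1 (tendsto_nhds_unique h h0)

theorem star_eq_neg_of_sq_eq_neg_one {I : Quaternion ℝ} (hI : I ^ 2 = -1) : star I = -I := by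
  have h1 : ‖I‖ ^ 2 = 1 := by rw [← norm_pow, hI, norm_neg, norm_one]
  have h2 : I * star I = 1 := by
    rw [Quaternion.self_mul_star, Quaternion.normSq_eq_norm_mul_self, ← sq, h1,
      Quaternion.coe_one]
  calc star I = -(I ^ 2 * star I) := by rw [hI]; simp
    _ = -I := by rw [sq, mul_assoc, h2, mul_one]

/-- The embedding of `ℂ` onto the slice `L_I`. -/
def sliceEmb (I : Quaternion ℝ) (hI : I ^ 2 = -1) : ℂ →ₐ[ℝ] Quaternion ℝ :=
  Complex.liftAux I (by rw [← sq, hI])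

section Slice

variable {I : Quaternion ℝ} (hI : I ^ 2 = -1)

theorem sliceEmb_apply (z : ℂ) : sliceEmb I hI z = (z.re : Quaternion ℝ) + z.im • I := rfl

theorem sliceEmb_ofReal (x : ℝ) : sliceEmb I hI x = (x : Quaternion ℝ) := by
  simp

theorem star_sliceEmb (z : ℂ) : star (sliceEmb I hI z) = sliceEmb I hI (starRingEnd ℂ z) := by
  rw [sliceEmb_apply, sliceEmb_apply, star_add, Quaternion.star_coe, Quaternion.star_smul,
    star_eq_neg_of_sq_eq_neg_one hI]
  simp

theorem norm_sliceEmb (z : ℂ) : ‖sliceEmb I hI z‖ = ‖z‖ := by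
  rw [← sq_eq_sq₀ (norm_nonneg _) (norm_nonneg _), ← Complex.normSq_eq_norm_sq, sq,
    ← Quaternion.normSq_eq_norm_mul_self, ← Quaternion.coe_inj, ← Quaternion.self_mul_star,
    star_sliceEmb, ← map_mul, Complex.mul_conj, sliceEmb_ofReal]

theorem continuous_sliceEmb : Continuous (sliceEmb I hI) :=
  (sliceEmb I hI).toLinearMap.continuous_of_finiteDimensional

theorem smul_expI_eq_sliceEmb (r θ : ℝ) :
    r • expI I θ = sliceEmb I hI (r * Complex.exp (θ * Complex.I)) := by
  rw [map_mul, sliceEmb_ofReal, Quaternion.coe_mul_eq_smul, sliceEmb_apply, expI,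
    Complex.exp_ofReal_mul_I_re, Complex.exp_ofReal_mul_I_im]

theorem B_sliceEmb (α z : ℂ) :
    B (sliceEmb I hI α) (sliceEmb I hI z) = sliceEmb I hI (complexBlaschke α z) := by
  simp [B, complexBlaschke, star_sliceEmb]

theorem Phi_sliceEmb {a : ℕ → Quaternion ℝ} {α : ℕ → ℂ}
    (ha : ∀ n, a (n + 1) = sliceEmb I hI (α n)) (k : ℕ) (z : ℂ) :
    Phi a (k + 1) (sliceEmb I hI z) = sliceEmb I hI ((Real.sqrt (1 - ‖α k‖ ^ 2) : ℝ) *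
      ((∏ j ∈ Finset.range k, complexBlaschke (α j) z) *
        (1 - z * starRingEnd ℂ (α k))⁻¹)) := by
  have hprod : ((List.range k).map fun j => B (a (j + 1)) (sliceEmb I hI z)).prod =
      sliceEmb I hI (∏ j ∈ Finset.range k, complexBlaschke (α j) z) := by
    induction k with
    | zero => simp
    | succ k ih =>
      rw [List.range_succ, List.map_append, List.prod_append, ih, Finset.prod_range_succ,
        map_mul, List.map_singleton, List.prod_singleton, ha, B_sliceEmb]
  rw [Phi, Nat.add_sub_cancel, hprod, ha, norm_sliceEmb, star_sliceEmb]
  simp [mul_assoc]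

/-- The projection of a quaternion onto the slice `L_I`, identified with `ℂ`. -/
def sliceProj (I : Quaternion ℝ) : Quaternion ℝ →L[ℝ] ℂ :=
  LinearMap.toContinuousLinearMap
    { toFun := fun q => ⟨q.re, -(I * q).re⟩
      map_add' := fun p q => by
        apply Complex.ext <;> simp [mul_add, -Quaternion.re_mul, -QuaternionAlgebra.re_mul]
        ring
      map_smul' := fun c q => by
        apply Complex.ext <;> simp [-Quaternion.re_mul, -QuaternionAlgebra.re_mul] }

theorem sliceProj_re (I q : Quaternion ℝ) : (sliceProj I q).re = q.re := rfl

theorem sliceProj_im (I q : Quaternion ℝ) : (sliceProj I q).im = -(I * q).re := rfl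

theorem sliceProj_sliceEmb_mul (z : ℂ) (q : Quaternion ℝ) :
    sliceProj I (sliceEmb I hI z * q) = z * sliceProj I q := by
  have h1 : sliceEmb I hI z * q = z.re • q + z.im • (I * q) := by
    rw [sliceEmb_apply, add_mul, Quaternion.coe_mul_eq_smul, smul_mul_assoc]
  have h2 : sliceProj I (I * q) = Complex.I * sliceProj I q := by
    have h3 : I * (I * q) = -q := by rw [← mul_assoc, ← sq, hI, neg_one_mul]
    apply Complex.ext
    · rw [sliceProj_re, Complex.mul_re, sliceProj_re, sliceProj_im]
      simp
    · rw [sliceProj_im, h3, Complex.mul_im, sliceProj_re, sliceProj_im]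
      simp
  rw [h1, map_add, map_smul, map_smul, h2, Complex.real_smul, Complex.real_smul]
  conv_rhs => rw [← Complex.re_add_im z]
  ring

end Slice

/-- **Theorem 4.2** (completeness of the slice regular Malmquist–Takenaka system in
`H²(𝔹)`): if the parameters lie on one slice and satisfy the non-Blaschke condition
`∑ (1 - ‖a_n‖) = +∞`, and `f(q) = ∑ qⁿ c_n` (with `∑ ‖c_n‖² < ∞`) is orthogonal to
every `Φ_k`, then `f ≡ 0`. -/
theorem MT_complete
    (I : Quaternion ℝ) (hI : I ^ 2 = -1)
    (a : ℕ → Quaternion ℝ)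
    (ha_slice : ∀ n, 1 ≤ n → ∃ x y : ℝ, a n = (x : Quaternion ℝ) + y • I)
    (ha_norm : ∀ n, 1 ≤ n → ‖a n‖ < 1)
    (hnonBlaschke : ¬ Summable (fun n : ℕ => 1 - ‖a (n + 1)‖))
    (c : ℕ → Quaternion ℝ) (hc : Summable (fun n => ‖c n‖ ^ 2))
    (f : Quaternion ℝ → Quaternion ℝ)
    (hf : ∀ q : Quaternion ℝ, ‖q‖ < 1 → f q = ∑' n : ℕ, q ^ n * c n)
    (horth : ∀ k, 1 ≤ k →
      Filter.Tendsto (fun r : ℝ =>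
          (1 / (2 * π)) • ∫ θ in (0:ℝ)..(2 * π),
            star (Phi a k (r • expI I θ)) * f (r • expI I θ))
        (nhdsWithin 1 (Set.Iio 1)) (nhds 0)) :
    ∀ n, c n = 0 := by
  let α : ℕ → ℂ := fun n =>
    ⟨(ha_slice (n + 1) n.succ_pos).choose, (ha_slice (n + 1) n.succ_pos).choose_spec.choose⟩
  have ha : ∀ n, a (n + 1) = sliceEmb I hI (α n) := fun n =>
    (ha_slice (n + 1) n.succ_pos).choose_spec.choose_spec
  have hαnorm : ∀ n, ‖a (n + 1)‖ = ‖α n‖ := fun n => by rw [ha, norm_sliceEmb]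
  have hα : ∀ n, ‖α n‖ < 1 := fun n => hαnorm n ▸ ha_norm (n + 1) n.succ_pos
  simp_rw [hαnorm] at hnonBlaschke
  obtain ⟨p, hp, hcomplete⟩ := exists_malmquistTakenaka_complete hα hnonBlaschke
  suffices hproj : ∀ w n, sliceProj I (c n * w) = 0 by
    intro n
    have h := congrArg Complex.re (hproj (star (c n)) n)
    rw [sliceProj_re, Quaternion.self_mul_star, Quaternion.re_coe, Complex.zero_re] at h
    exact Quaternion.normSq_eq_zero.1 h
  intro w
  have hmem : Memℓp (fun n => sliceProj I (c n * w)) 2 := by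
    rw [memℓp_two_iff_summable_sq]
    refine Summable.of_nonneg_of_le (fun n => by positivity) (fun n => ?_)
      (hc.mul_left ((‖sliceProj I‖ * ‖w‖) ^ 2))
    rw [← mul_pow]
    refine pow_le_pow_left₀ (norm_nonneg _) (((sliceProj I).le_opNorm _).trans_eq ?_) 2
    rw [norm_mul]
    ring
  let u : HardySeq := ⟨fun n => sliceProj I (c n * w), hmem⟩
  have hfsum : ∀ z : ℂ, ‖z‖ < 1 → Summable fun n => sliceEmb I hI z ^ n * c n := fun z hz => by
    refine Summable.of_norm ((summable_pow_mul_norm hc (norm_nonneg z) hz).congr fun n => ?_)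
    rw [norm_mul, norm_pow, norm_sliceEmb]
  have hfu : ∀ z : ℂ, ‖z‖ < 1 → sliceProj I (f (sliceEmb I hI z) * w) = hardyEval z u := by
    intro z hz
    have hs := ((hfsum z hz).mul_right w).hasSum.mapL (sliceProj I)
    rw [hf _ (by rwa [norm_sliceEmb]), ← (hfsum z hz).tsum_mul_right, ← hs.tsum_eq]
    refine tsum_congr fun n => ?_
    rw [← map_pow, mul_assoc, sliceProj_sliceEmb_mul]
  have hPhi : ∀ k z, ‖z‖ < 1 → Phi a (k + 1) (sliceEmb I hI z) =
      sliceEmb I hI (hardyEval z ((Real.sqrt (1 - ‖α k‖ ^ 2) : ℂ) • p k)) := fun k z hz => by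
    rw [Phi_sliceEmb hI ha, hardyEval_smul hz, hp k z hz]
  suffices hinner : ∀ k, inner ℂ (p k) u = 0 by
    have hu := eq_zero_of_hardyEval_eq_zero (hcomplete u hinner)
    intro n
    exact congrFun (congrArg Subtype.val hu) n
  intro k
  have hsqrt : (Real.sqrt (1 - ‖α k‖ ^ 2) : ℂ) ≠ 0 := by
    have : 0 < 1 - ‖α k‖ ^ 2 := by nlinarith [norm_nonneg (α k), hα k]
    exact_mod_cast (Real.sqrt_pos.2 this).ne'
  set P : HardySeq := (Real.sqrt (1 - ‖α k‖ ^ 2) : ℂ) • p k with hP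
  suffices hPu : inner ℂ P u = 0 by
    rw [hP, inner_smul_left, mul_eq_zero] at hPu
    exact hPu.resolve_left ((map_ne_zero _).2 hsqrt)
  let T : Quaternion ℝ →L[ℝ] ℂ := (sliceProj I).comp ((ContinuousLinearMap.mul ℝ _).flip w)
  have hT : ∀ q, T q = sliceProj I (q * w) := fun _ => rfl
  have hlim := (T.continuous.tendsto 0).comp (horth (k + 1) k.succ_pos)
  rw [map_zero] at hlim
  refine tendsto_nhds_unique (tendsto_integral_conj_hardyEval_mul P u) (hlim.congr' ?_)
  filter_upwards [self_mem_nhdsWithin, mem_nhdsWithin_of_mem_nhds (lt_mem_nhds one_pos)]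
    with r hr hr0
  have hr0' : 0 ≤ r := le_of_lt hr0
  have hz : ∀ θ : ℝ, ‖(r : ℂ) * Complex.exp (θ * Complex.I)‖ < 1 := fun θ => by
    rw [norm_ofReal_mul_exp hr0']; exact hr
  have hcont : Continuous fun θ : ℝ =>
      star (Phi a (k + 1) (r • expI I θ)) * f (r • expI I θ) := by
    simp_rw [smul_expI_eq_sliceEmb hI, hPhi k _ (hz _), hf _ ((norm_sliceEmb hI _).trans_lt (hz _))]
    refine Continuous.mul (continuous_star.comp
      ((continuous_sliceEmb hI).comp (continuous_hardyEval_circle hr0' hr P))) ?_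
    exact continuous_tsum_pow_mul hc hr0' hr ((continuous_sliceEmb hI).comp (by fun_prop))
      fun θ => by rw [norm_sliceEmb, norm_ofReal_mul_exp hr0']
  rw [Function.comp_apply, map_smul, ← T.intervalIntegral_comp_comm (hcont.intervalIntegrable _ _)]
  congr 1
  refine intervalIntegral.integral_congr fun θ _ => ?_
  simp only [hT]
  rw [smul_expI_eq_sliceEmb hI, hPhi k _ (hz θ), star_sliceEmb, mul_assoc, sliceProj_sliceEmb_mul,
    hfu _ (hz θ)]
end
end

section
/- Darboux–Christoffel formula for the quaternionic Malmquist–Takenaka system: let (a_n)_{n≥1} be any sequence of quaternions with ‖a_n‖ < 1, and let Φ_n be the classical quaternionic Malmquist–Takenaka functions. Then for every n ≥ 1 and all z, w ∈ ℍ with ‖z‖ ≤ 1, ‖w‖ ≤ 1 and z ≠ w, one has ∑_{ℓ=1}^{n} Φ_ℓ(z)·(1 - z·conj(w))·conj(Φ_ℓ(w)) = 1 - (∏_{ℓ=1}^{n} B_{a_ℓ}(z))·(∏_{ℓ=1}^{n} conj(B_{a_{n-ℓ+1}}(w))), where both products are quaternionic products taken in increasing order of ℓ. -/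
open scoped Real
noncomputable section

theorem one_sub_mul_star_ne_zero {a q : Quaternion ℝ} (ha : ‖a‖ < 1) (hq : ‖q‖ ≤ 1) :
    1 - q * star a ≠ 0 := by
  intro h
  have h1 : ‖q * star a‖ = 1 := by rw [← sub_eq_zero.mp h, norm_one]
  rw [norm_mul, norm_star] at h1
  nlinarith [norm_nonneg a, norm_nonneg q]

theorem one_sub_B_mul_star_B {a z w : Quaternion ℝ} (ha : ‖a‖ < 1) (hz : ‖z‖ ≤ 1)
    (hw : ‖w‖ ≤ 1) :
    1 - B a z * star (B a w) =
      (1 - z * star a)⁻¹ * (((1 - ‖a‖ ^ 2 : ℝ) : Quaternion ℝ) * (1 - z * star w)) *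
        star (1 - w * star a)⁻¹ := by
  have hz' := one_sub_mul_star_ne_zero ha hz
  have hw' : star (1 - w * star a) ≠ 0 := star_ne_zero.mpr (one_sub_mul_star_ne_zero ha hw)
  have key : ((1 - ‖a‖ ^ 2 : ℝ) : Quaternion ℝ) * (1 - z * star w) =
      (1 - z * star a) * star (1 - w * star a) - (z - a) * star (w - a) := by
    have hN : ((‖a‖ ^ 2 : ℝ) : Quaternion ℝ) = star a * a := by
      rw [Quaternion.star_mul_self, Quaternion.normSq_eq_norm_mul_self, sq]
    have hN' : ((‖a‖ ^ 2 : ℝ) : Quaternion ℝ) = a * star a := by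
      rw [Quaternion.self_mul_star, Quaternion.normSq_eq_norm_mul_self, sq]
    have hc : ((‖a‖ ^ 2 : ℝ) : Quaternion ℝ) * (z * star w) = z * (star a * a) * star w := by
      rw [← hN, ← mul_assoc, Quaternion.coe_commutes]
    rw [Quaternion.coe_sub, Quaternion.coe_one, sub_mul, one_mul, mul_sub, hc, mul_one, hN']
    simp only [star_sub, star_one, star_mul, star_star]
    noncomm_ring
  rw [key, mul_sub, sub_mul, inv_mul_cancel_left₀ hz', star_inv₀, mul_inv_cancel₀ hw', B, B,
    star_mul, star_inv₀]
  simp only [mul_assoc]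

theorem star_prod_range_map {R : Type*} [Monoid R] [StarMul R] (f : ℕ → R) (n : ℕ) :
    star ((List.range n).map (fun k => f (k + 1))).prod =
      ((List.range n).map (fun k => star (f (n - k)))).prod := by
  induction n with
  | zero => simp
  | succ n ih =>
    rw [List.range_succ, List.map_append, List.prod_append, star_mul, ih, ← List.range_succ,
      List.range_succ_eq_map]
    simp [Function.comp_def]

theorem Phi_succ_mul_star_Phi_succ {a : ℕ → Quaternion ℝ} {n : ℕ} {z w : Quaternion ℝ}
    (ha : ‖a (n + 1)‖ < 1) (hz : ‖z‖ ≤ 1) (hw : ‖w‖ ≤ 1) :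
    Phi a (n + 1) z * (1 - z * star w) * star (Phi a (n + 1) w) =
      ((List.range n).map (fun k => B (a (k + 1)) z)).prod *
        (1 - B (a (n + 1)) z * star (B (a (n + 1)) w)) *
        star ((List.range n).map (fun k => B (a (k + 1)) w)).prod := by
  have hs : 0 ≤ 1 - ‖a (n + 1)‖ ^ 2 := by nlinarith [norm_nonneg (a (n + 1))]
  rw [one_sub_B_mul_star_B ha hz hw]
  simp only [Phi, Nat.add_sub_cancel, star_mul, Quaternion.star_smul,
    Quaternion.coe_mul_eq_smul, smul_mul_assoc, mul_smul_comm,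
    smul_smul, Real.mul_self_sqrt hs, mul_assoc]

/-- **Darboux–Christoffel formula** for the quaternionic Malmquist–Takenaka system:
`∑_{ℓ=1}^n Φ_ℓ(z)·(1 - z·conj(w))·conj(Φ_ℓ(w))
  = 1 - (∏_{ℓ=1}^n B_{a_ℓ}(z))·(∏_{ℓ=1}^n conj(B_{a_{n-ℓ+1}}(w)))`,
both products taken in increasing order of `ℓ`. -/
theorem MT_darboux_christoffel
    (a : ℕ → Quaternion ℝ) (ha : ∀ n, 1 ≤ n → ‖a n‖ < 1)
    (n : ℕ) (hn : 1 ≤ n)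
    (z w : Quaternion ℝ) (hz : ‖z‖ ≤ 1) (hw : ‖w‖ ≤ 1) (hzw : z ≠ w) :
    ∑ ℓ ∈ Finset.Icc 1 n, Phi a ℓ z * (1 - z * star w) * star (Phi a ℓ w) =
      1 - (((List.range n).map (fun ℓ => B (a (ℓ + 1)) z)).prod) *
          (((List.range n).map (fun ℓ => star (B (a (n - ℓ)) w))).prod) := by
  clear hn hzw
  rw [← star_prod_range_map (fun k => B (a k) w)]
  induction n with
  | zero => simp
  | succ n ih =>
    rw [Finset.sum_Icc_succ_top (by omega), ih,
      Phi_succ_mul_star_Phi_succ (ha (n + 1) (by omega)) hz hw]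
    simp only [List.range_succ, List.map_append, List.prod_append, List.map_singleton,
      List.prod_singleton, star_mul]
    noncomm_ring
end
end

section
/- Let I ∈ ℍ be an imaginary unit and let a ∈ L_I with ‖a‖ < 1. Then ((1 - ‖a‖²)/(2π))·∫₀^{2π} conj((1 - e^{Iθ}·conj(a))⁻¹)·(1 - e^{Iθ}·conj(a))⁻¹ dθ = 1 (an identity of quaternions; this computes the unit H²-norm of the Malmquist–Takenaka function with single parameter a on the slice). -/
open scoped Real
noncomputable section

theorem imaginaryUnit_normSq {I : Quaternion ℝ} (hI : I ^ 2 = -1) :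
    Quaternion.normSq I = 1 := by
  have h : Quaternion.normSq I ^ 2 = 1 := by
    rw [← map_pow, hI, Quaternion.normSq_neg, map_one]
  exact (pow_eq_one_iff_of_nonneg Quaternion.normSq_nonneg two_ne_zero).1 h

theorem imaginaryUnit_re {I : Quaternion ℝ} (hI : I ^ 2 = -1) : I.re = 0 := by
  rw [← Quaternion.sq_eq_neg_normSq, imaginaryUnit_normSq hI, hI, Quaternion.coe_one]

theorem normSq_slice {I : Quaternion ℝ} (hI : I ^ 2 = -1) (u v : ℝ) :
    Quaternion.normSq ((u : Quaternion ℝ) + v • I) = u ^ 2 + v ^ 2 := by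
  have h := imaginaryUnit_normSq hI
  have h0 := imaginaryUnit_re hI
  rw [Quaternion.normSq_def'] at h ⊢
  simp only [Quaternion.re_add, Quaternion.imI_add, Quaternion.imJ_add, Quaternion.imK_add,
    Quaternion.re_coe, Quaternion.imI_coe, Quaternion.imJ_coe, Quaternion.imK_coe,
    Quaternion.re_smul, Quaternion.imI_smul, Quaternion.imJ_smul, Quaternion.imK_smul,
    smul_eq_mul, h0] at h ⊢
  linear_combination v ^ 2 * h

theorem one_sub_expI_mul_star {I : Quaternion ℝ} (hI : I ^ 2 = -1) (x y θ : ℝ) :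
    1 - expI I θ * star ((x : Quaternion ℝ) + y • I) =
      ((1 - Real.cos θ * x - Real.sin θ * y : ℝ) : Quaternion ℝ) +
        (Real.cos θ * y - Real.sin θ * x) • I := by
  have hs : star I = -I := Quaternion.star_eq_neg.2 (imaginaryUnit_re hI)
  simp only [expI, star_add, Quaternion.star_smul, hs, Quaternion.star_coe]
  simp only [← Quaternion.coe_mul_eq_smul, Quaternion.coe_sub, Quaternion.coe_mul, Quaternion.coe_one]
  have hx := Quaternion.coe_commutes x I
  have hy := Quaternion.coe_commutes y I
  have hI' : I * I = -1 := by rw [← sq, hI]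
  have h : (Real.sin θ : Quaternion ℝ) * I * ((y : Quaternion ℝ) * I) =
      -((Real.sin θ : Quaternion ℝ) * y) := by
    rw [hy, mul_assoc, ← mul_assoc I I, hI']; simp
  simp only [add_mul, mul_add, mul_neg, h, sub_mul]
  rw [mul_assoc _ I, ← hx]
  noncomm_ring

theorem integral_inv_norm_circleMap_sub_sq {w : ℂ} (hw : ‖w‖ < 1) :
    (1 - ‖w‖ ^ 2) / (2 * π) * ∫ θ in (0 : ℝ)..(2 * π), (‖circleMap 0 1 θ - w‖ ^ 2)⁻¹ = 1 := by
  have h := (InnerProductSpace.harmonicOnNhd_const (s := Metric.closedBall (0 : ℂ) 1)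
    (1 : ℝ)).circleAverage_poissonKernel_smul (w := w) (by simpa using hw)
  simp only [Real.circleAverage_def, smul_eq_mul, Pi.mul_apply, poissonKernel_def, sub_zero,
    norm_circleMap_zero, abs_one, one_pow, mul_one, div_eq_mul_inv,
    intervalIntegral.integral_const_mul] at h ⊢
  linear_combination h

/-- For an imaginary unit `I` and `a ∈ L_I` with `‖a‖ < 1`,
`((1 - ‖a‖²)/(2π))·∫₀^{2π} conj((1 - e^{Iθ}·conj(a))⁻¹)·(1 - e^{Iθ}·conj(a))⁻¹ dθ = 1`
(the unit `H²`-norm of the Malmquist–Takenaka function with single parameter `a`). -/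
theorem MT_single_norm_one
    (I : Quaternion ℝ) (hI : I ^ 2 = -1)
    (a : Quaternion ℝ) (haI : ∃ x y : ℝ, a = (x : Quaternion ℝ) + y • I)
    (ha : ‖a‖ < 1) :
    ((1 - ‖a‖ ^ 2) / (2 * π)) • ∫ θ in (0:ℝ)..(2 * π),
        star ((1 - expI I θ * star a)⁻¹) * (1 - expI I θ * star a)⁻¹ =
      (1 : Quaternion ℝ) := by
  obtain ⟨x, y, rfl⟩ := haI
  have hnorm : ‖(x : Quaternion ℝ) + y • I‖ = ‖(⟨x, y⟩ : ℂ)‖ := by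
    rw [← sq_eq_sq₀ (norm_nonneg _) (norm_nonneg _), sq, ← Quaternion.normSq_eq_norm_mul_self,
      normSq_slice hI, Complex.sq_norm, Complex.normSq_mk]
    ring
  have hint (θ : ℝ) : star ((1 - expI I θ * star ((x : Quaternion ℝ) + y • I))⁻¹) *
      (1 - expI I θ * star ((x : Quaternion ℝ) + y • I))⁻¹ =
        (‖circleMap 0 1 θ - ⟨x, y⟩‖ ^ 2)⁻¹ • (1 : Quaternion ℝ) := by
    have hsq : Quaternion.normSq (1 - expI I θ * star ((x : Quaternion ℝ) + y • I)) =
        ‖circleMap 0 1 θ - ⟨x, y⟩‖ ^ 2 := by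
      rw [one_sub_expI_mul_star hI, normSq_slice hI, Complex.sq_norm, Complex.normSq_apply]
      simp only [circleMap_zero, Complex.ofReal_one, one_mul, Complex.sub_re, Complex.sub_im,
        Complex.exp_ofReal_mul_I_re, Complex.exp_ofReal_mul_I_im]
      linear_combination (x ^ 2 + y ^ 2 - 1) * Real.sin_sq_add_cos_sq θ
    rw [Quaternion.star_mul_self, Quaternion.normSq_inv, hsq, ← Quaternion.coe_mul_eq_smul,
      mul_one]
  rw [hnorm] at ha ⊢
  simp only [hint]
  rw [intervalIntegral.integral_smul_const, smul_smul, integral_inv_norm_circleMap_sub_sq ha,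
    one_smul]
end
end

section
/- Identity principle across slices for quaternionic power series: let c : ℕ → ℍ satisfy ∑_{n≥0} ‖c_n‖² < ∞ and let f(q) = ∑_{n≥0} qⁿ·c_n for q in the open unit ball 𝔹 of ℍ. If there exists an imaginary unit I such that f(z) = 0 for every z ∈ 𝔹_I = 𝔹 ∩ L_I, then c_n = 0 for all n, i.e., f vanishes identically on 𝔹. (A regular function on 𝔹 is uniquely determined by its restriction to a single slice.) -/
noncomputable section

/-- A power series in one variable over a nontrivially normed field whose sum is zero near `0`
has vanishing coefficients. -/
theorem eq_zero_of_eventually_hasSum_pow_smul {𝕜 E : Type*} [NontriviallyNormedField 𝕜]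
    [NormedAddCommGroup E] [NormedSpace 𝕜 E] {c : ℕ → E}
    (h : ∀ᶠ x : 𝕜 in nhds 0, HasSum (fun n => x ^ n • c n) 0) (n : ℕ) : c n = 0 := by
  let p : FormalMultilinearSeries 𝕜 𝕜 E :=
    fun n => ContinuousMultilinearMap.mkPiRing 𝕜 (Fin n) (c n)
  have hcoeff : ∀ n, p.coeff n = c n := fun n => by
    simp [p, FormalMultilinearSeries.coeff]
  have hp : HasFPowerSeriesAt (0 : 𝕜 → E) p 0 := by
    rw [hasFPowerSeriesAt_iff]
    simpa only [hcoeff, Pi.zero_apply] using h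
  rw [← hcoeff, hp.eq_zero]
  simp [FormalMultilinearSeries.coeff]

/-- A power series with square-summable coefficients converges on the open unit disc. -/
theorem summable_pow_smul_of_summable_norm_sq {𝕜 E : Type*} [NormedField 𝕜]
    [NormedAddCommGroup E] [NormedSpace 𝕜 E] [CompleteSpace E] {c : ℕ → E}
    (hc : Summable fun n => ‖c n‖ ^ 2) {x : 𝕜} (hx : ‖x‖ < 1) :
    Summable fun n => x ^ n • c n := by
  have hgeom : Summable fun n => (‖x‖ ^ 2) ^ n :=
    summable_geometric_of_lt_one (by positivity) (pow_lt_one₀ (norm_nonneg x) hx two_ne_zero)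
  refine Summable.of_norm_bounded (hgeom.add hc) fun n => ?_
  rw [norm_smul, norm_pow, ← pow_mul, mul_comm 2 n, pow_mul]
  nlinarith [sq_nonneg (‖x‖ ^ n - ‖c n‖), sq_nonneg (‖x‖ ^ n), sq_nonneg ‖c n‖]

/-- **Identity principle across slices** for quaternionic power series: if
`f(q) = ∑ qⁿ c_n` (with `∑ ‖c_n‖² < ∞`) vanishes on one slice disc
`𝔹_I = 𝔹 ∩ L_I`, then all coefficients `c_n` vanish, i.e. `f ≡ 0` on `𝔹`. -/
theorem identity_principle_slice
    (c : ℕ → Quaternion ℝ) (hc : Summable (fun n => ‖c n‖ ^ 2))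
    (f : Quaternion ℝ → Quaternion ℝ)
    (hf : ∀ q : Quaternion ℝ, ‖q‖ < 1 → f q = ∑' n : ℕ, q ^ n * c n)
    (I : Quaternion ℝ) (hI : I ^ 2 = -1)
    (hvanish : ∀ z : Quaternion ℝ, ‖z‖ < 1 →
      (∃ x y : ℝ, z = (x : Quaternion ℝ) + y • I) → f z = 0) :
    ∀ n, c n = 0 := by
  refine eq_zero_of_eventually_hasSum_pow_smul (𝕜 := ℝ) ?_
  filter_upwards [Metric.ball_mem_nhds (0 : ℝ) one_pos] with x hx
  rw [mem_ball_zero_iff] at hx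
  have hx' : ‖(x : Quaternion ℝ)‖ < 1 := by simpa using hx
  have hsum : ∑' n, x ^ n • c n = 0 := by
    rw [← hvanish x hx' ⟨x, 0, by simp⟩, hf x hx']
    simp only [← Quaternion.coe_pow, Quaternion.coe_mul_eq_smul]
  exact hsum ▸ (summable_pow_smul_of_summable_norm_sq hc hx).hasSum
end
end
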